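/- Let Ω be a finite nonempty set, Λ ⊆ [0,∞]^Ω, c ≥ 1 and η > 0 reals, and λ : 𝒫(Ω) → Λ a continuous map such that for every g ∈ Λ the function q_g(π,ω) := exp(η·λ(π)(ω)/c)·exp(−η·g(ω)) is forecast-continuous and has the supermartingale property. Let Θ be a nonempty countable set and P₀ : Θ → (0,1] with ∑_{θ∈Θ} P₀(θ) = 1. In the prediction-with-second-guessing-expert-advice protocol, let Γ_n^θ : Λ → Λ (n ≥ 1, θ ∈ Θ) be continuous maps (Λ with the subspace topology of [0,∞]^Ω), π_n ∈ 𝒫(Ω) Learner's decisions and ω_n ∈ Ω the outcomes, and define W_n := ∑_{θ∈Θ} P₀(θ)·∏_{k=1}^{n} exp(η·λ(π_k)(ω_k)/c)·exp(−η·Γ_k^θ(λ(π_k))(ω_k)) (so W_0 = 1). Then: (i) for every n ≥ 1, given any π_1,…,π_{n−1}, ω_1,…,ω_{n−1} and continuous Γ_k^θ (k ≤ n), there exists π_n ∈ 𝒫(Ω) such that for all ω ∈ Ω, ∑_{θ∈Θ} P₀(θ)·(∏_{k=1}^{n−1} exp(η·λ(π_k)(ω_k)/c)·exp(−η·Γ_k^θ(λ(π_k))(ω_k)))·exp(η·λ(π_n)(ω)/c)·exp(−η·Γ_n^θ(λ(π_n))(ω))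 ≤ W_{n−1}; (ii) if N ≥ 1 and π_1,…,π_N satisfy W_n ≤ W_{n−1} for n = 1,…,N, then for every θ ∈ Θ: ∑_{n=1}^N λ(π_n)(ω_n) ≤ c·∑_{n=1}^N Γ_n^θ(λ(π_n))(ω_n) + (c/η)·ln(1/P₀(θ)) in [0,∞]. -/

import Mathlib

open scoped ENNReal BigOperators
open Filter

noncomputable section

variable {Ω : Type*} [Fintype Ω]

/-- `pexp r t = exp(r·t)` for `t ∈ [0,∞]`, with value `∞` when `t = ∞`. -/
def pexp (r : ℝ) (t : ℝ≥0∞) : ℝ≥0∞ :=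
  if t = ∞ then ∞ else ENNReal.ofReal (Real.exp (r * t.toReal))

/-- `nexp r t = exp(−r·t)` for `t ∈ [0,∞]`, with value `0` when `t = ∞`. -/
def nexp (r : ℝ) (t : ℝ≥0∞) : ℝ≥0∞ :=
  if t = ∞ then 0 else ENNReal.ofReal (Real.exp (-(r * t.toReal)))

/-- Expectation `E_π g = ∑_{ω : π ω ≠ 0} π(ω)·g(ω)` in `[0,∞]` (since `0·∞ = 0` in
`ℝ≥0∞`, the terms with `π ω = 0` contribute nothing, so we may sum over all `ω`). -/
def expect (π : Ω → ℝ) (g : Ω → ℝ≥0∞) : ℝ≥0∞ :=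
  ∑ ω, ENNReal.ofReal (π ω) * g ω

/-- The superprediction set `Σ_Λ` of a game `(Ω, Λ)`. -/
def superpred (Λ : Set (Ω → ℝ≥0∞)) : Set (Ω → ℝ≥0∞) :=
  {g | ∃ γ ∈ Λ, ∀ ω, γ ω ≤ g ω}

/-- `−(1/η)·ln x`, with value `∞` at `x = 0`. -/
def negLogDiv (η : ℝ) (x : ℝ≥0∞) : ℝ≥0∞ :=
  if x = 0 then ∞ else ENNReal.ofReal (-(1 / η) * Real.log x.toReal)

/-- The exp-convex hull `Σ_Λ^η` of the superprediction set. -/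
def expHull (η : ℝ) (Λ : Set (Ω → ℝ≥0∞)) : Set (Ω → ℝ≥0∞) :=
  {g | ∃ k : ℕ, 0 < k ∧ ∃ (gs : Fin k → Ω → ℝ≥0∞) (ρ : Fin k → ℝ),
    (∀ i, gs i ∈ superpred Λ) ∧ (∀ i, 0 ≤ ρ i) ∧ (∑ i, ρ i = 1) ∧
    ∀ ω, g ω = negLogDiv η (∑ i, ENNReal.ofReal (ρ i) * nexp η (gs i ω))}

/-- The set of minimal elements of `X`. -/
def minSet (X : Set (Ω → ℝ≥0∞)) : Set (Ω → ℝ≥0∞) :=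
  {g | g ∈ X ∧ ∀ g' ∈ X, (∀ ω, g' ω ≤ g ω) → g' = g}

section Scarf
open Finset

/-- A set `S` is dominant for the orders `r i` if no point `y` lies strictly above the minimum
of `S` in every one of the orders. -/
def IsDominant {I V L : Type*} [LinearOrder L] (r : I → V → L) (S : Finset V) : Prop :=
  ∀ y, ∃ i, ∀ x ∈ S, r i y ≤ r i x

variable {I V L : Type*} [LinearOrder L] {r : I → V → L}

theorem IsDominant.mono {S T : Finset V} (hS : IsDominant r S) (h : T ⊆ S) : IsDominant r T :=
  fun y => (hS y).imp fun _ hi x hx => hi x (h hx)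

/-- Every point of a dominant set is its minimum in one of the orders. -/
theorem IsDominant.exists_eq_argmin (hr : ∀ i, Function.Injective (r i)) {S : Finset V}
    (hS : IsDominant r S) {m : I → V} (hm : ∀ i, m i ∈ S) (hmin : ∀ i, ∀ x ∈ S, r i (m i) ≤ r i x)
    {x : V} (hx : x ∈ S) : ∃ i, m i = x := by
  obtain ⟨i, hi⟩ := hS x
  exact ⟨i, hr i (le_antisymm (hmin i x hx) (hi _ (hm i)))⟩

variable [Fintype I] [DecidableEq I] [DecidableEq V]

/-- The number of facets of `S` whose colours are exactly those different from `i₀` is even,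
unless `S` carries all the colours. -/
theorem even_card_filter_image_erase (c : V → I) (i₀ : I) {S : Finset V}
    (hcard : #S = Fintype.card I) (hS : S.image c ≠ univ) :
    Even #{x ∈ S | (S.erase x).image c = univ.erase i₀} := by
  by_cases hx : ∃ x ∈ S, (S.erase x).image c = univ.erase i₀
  swap
  · rw [filter_false_of_mem (by simpa using hx)]
    simp
  obtain ⟨x, hxS, hx⟩ := hx
  have hcx : c x ≠ i₀ := by
    rintro rfl
    apply hS
    rw [← insert_erase hxS, image_insert, hx, insert_erase (mem_univ _)]
  have hinj : Set.InjOn c (S.erase x) := by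
    rw [← card_image_iff, hx, card_erase_of_mem (mem_univ _), card_erase_of_mem hxS, card_univ,
      hcard]
  have hne : ∀ w ∈ S.erase x, c w ≠ i₀ := fun w hw =>
    ne_of_mem_erase (hx ▸ mem_image_of_mem c hw)
  have hex : ∀ i ≠ i₀, ∃ w ∈ S.erase x, c w = i := fun i hi =>
    mem_image.1 (hx ▸ mem_erase.2 ⟨hi, mem_univ i⟩)
  obtain ⟨x', hx'S, hx'⟩ := hex (c x) hcx
  have hxx' : x ≠ x' := (ne_of_mem_erase hx'S).symm
  suffices ({z ∈ S | (S.erase z).image c = univ.erase i₀} : Finset V) = {x, x'} by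
    rw [this, card_pair hxx']
    exact even_two
  ext z
  simp only [mem_filter, mem_insert, mem_singleton]
  constructor
  · rintro ⟨hzS, hz⟩
    by_contra! hzx
    have hzx' : z ∈ S.erase x := mem_erase.2 ⟨hzx.1, hzS⟩
    have : c z ∈ (S.erase z).image c := hz ▸ mem_erase.2 ⟨hne z hzx', mem_univ _⟩
    obtain ⟨w, hw, hwz⟩ := mem_image.1 this
    by_cases hwx : w = x
    · subst hwx
      exact hzx.2 (hinj hzx' hx'S (hwz.symm.trans hx'.symm))
    · exact ne_of_mem_erase hw
        (hinj (mem_erase.2 ⟨hwx, mem_of_mem_erase hw⟩) hzx' hwz)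
  · rintro (rfl | rfl)
    · exact ⟨hxS, hx⟩
    · refine ⟨mem_of_mem_erase hx'S, ?_⟩
      ext i
      simp only [mem_image, mem_erase, mem_univ, and_true]
      constructor
      · rintro ⟨w, ⟨-, hw⟩, rfl⟩
        by_cases hwx : w = x
        · exact hwx ▸ hcx
        · exact hne w (mem_erase.2 ⟨hwx, hw⟩)
      · intro hi
        obtain ⟨w, hw, rfl⟩ := hex i hi
        by_cases hwx : w = z
        · exact ⟨x, ⟨hxx', hxS⟩, by rw [hwx, hx']⟩
        · exact ⟨w, ⟨hwx, mem_of_mem_erase hw⟩, rfl⟩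

variable [Fintype V]

open Classical in
/-- A dominant set with one element fewer than there are orders, which can be exceeded in all
orders but any given one, extends to a dominant set in exactly two ways. -/
theorem IsDominant.card_extensions_eq_two (hr : ∀ i, Function.Injective (r i)) {T : Finset V}
    (hT : IsDominant r T) (hne : T.Nonempty) (hcard : #T + 1 = Fintype.card I)
    (hY : ∀ a, ∃ y, ∀ i ≠ a, ∃ x ∈ T, r i x < r i y) :
    #{v | v ∉ T ∧ IsDominant r (insert v T)} = 2 := by
  choose m hm hmin using fun i => T.exists_min_image (r i) hne
  have hsurj : ∀ x ∈ T, ∃ i, m i = x := fun x hx => hT.exists_eq_argmin hr hm hmin hx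
  obtain ⟨a, -, b, -, hab, hmab⟩ := Finset.exists_ne_map_eq_of_card_lt_of_maps_to
    (s := (univ : Finset I)) (t := T) (by rw [card_univ]; omega) (f := m) (fun i _ => hm i)
  have hmax : ∀ a, ∃ v, (∀ i ≠ a, r i (m i) < r i v) ∧
      ∀ y, (∀ i ≠ a, r i (m i) < r i y) → r a y ≤ r a v := by
    intro a
    obtain ⟨y, hy⟩ := hY a
    obtain ⟨v, hv, hvmax⟩ := ({y | ∀ i ≠ a, r i (m i) < r i y} : Finset V).exists_max_image (r a)
      ⟨y, by
        simp only [mem_filter, mem_univ, true_and]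
        intro i hi
        obtain ⟨x, hx, hxy⟩ := hy i hi
        exact (hmin i x hx).trans_lt hxy⟩
    simp only [mem_filter, mem_univ, true_and] at hv hvmax
    exact ⟨v, hv, hvmax⟩
  have hext : ∀ a b, a ≠ b → m a = m b → ∀ v, (∀ i ≠ a, r i (m i) < r i v) →
      (∀ y, (∀ i ≠ a, r i (m i) < r i y) → r a y ≤ r a v) →
      v ∉ T ∧ IsDominant r (insert v T) := by
    intro a b hab hmab v hv hvmax
    refine ⟨fun hvT => ?_, fun y => ?_⟩
    · obtain ⟨i, rfl⟩ := hsurj v hvT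
      by_cases hi : i = a
      · subst hi
        have := hv b hab.symm
        rw [hmab] at this
        exact lt_irrefl _ this
      · exact lt_irrefl _ (hv i hi)
    · by_cases hy : ∀ i ≠ a, r i (m i) < r i y
      · obtain ⟨i, hi⟩ := hT y
        have hia : i = a := by
          by_contra hia
          exact absurd (hi _ (hm i)) (not_le.2 (hy i hia))
        subst hia
        refine ⟨i, fun x hx => ?_⟩
        rcases mem_insert.1 hx with rfl | hx
        · exact hvmax y hy
        · exact hi x hx
      · push Not at hy
        obtain ⟨i, hia, hi⟩ := hy
        refine ⟨i, fun x hx => ?_⟩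
        rcases mem_insert.1 hx with rfl | hx
        · exact hi.trans (hv i hia).le
        · exact hi.trans (hmin i x hx)
  obtain ⟨va, hva, hvamax⟩ := hmax a
  obtain ⟨vb, hvb, hvbmax⟩ := hmax b
  have hvab : va ≠ vb := by
    rintro rfl
    obtain ⟨i, hi⟩ := hT va
    have hi := hi _ (hm i)
    by_cases hia : i = a
    · exact absurd hi (not_le.2 (hvb i (hia ▸ hab)))
    · exact absurd hi (not_le.2 (hva i hia))
  suffices ({v | v ∉ T ∧ IsDominant r (insert v T)} : Finset V) = {va, vb} by
    rw [this, card_pair hvab]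
  ext v
  simp only [mem_filter, mem_univ, true_and, mem_insert, mem_singleton]
  constructor
  · rintro ⟨hvT, hdom⟩
    choose m' hm' hmin' using fun i => (insert v T).exists_min_image (r i) (insert_nonempty v T)
    have hsurj' : ∀ x ∈ insert v T, ∃ i, m' i = x := fun x hx =>
      hdom.exists_eq_argmin hr hm' hmin' hx
    have hinj' : Function.Injective m' := by
      have himg : univ.image m' = insert v T := by
        ext x
        simp only [mem_image, mem_univ, true_and]
        exact ⟨by rintro ⟨i, rfl⟩; exact hm' i, hsurj' x⟩
      have : #(univ.image m') = #(univ : Finset I) := by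
        rw [himg, card_insert_of_notMem hvT, hcard, card_univ]
      exact fun i j h => card_image_iff.1 this (mem_coe.2 (mem_univ i)) (mem_coe.2 (mem_univ j)) h
    obtain ⟨k, hk⟩ := hsurj' v (mem_insert_self v T)
    have heq : ∀ i ≠ k, m' i = m i := by
      intro i hi
      have hiT : m' i ∈ T := (mem_insert.1 (hm' i)).resolve_left fun h =>
        hi (hinj' (h.trans hk.symm))
      exact hr i (le_antisymm (hmin' i _ (mem_insert_of_mem (hm i))) (hmin i _ hiT))
    have hvk : ∀ i ≠ k, r i (m i) < r i v := by
      intro i hi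
      refine lt_of_le_of_ne ?_ fun h => hvT (hr i h ▸ hm i)
      rw [← heq i hi]
      exact hmin' i v (mem_insert_self v T)
    have hvkmax : ∀ y, (∀ i ≠ k, r i (m i) < r i y) → r k y ≤ r k v := by
      intro y hy
      obtain ⟨i, hi⟩ := hdom y
      by_cases hik : i = k
      · subst hik
        exact hi v (mem_insert_self v T)
      · exact absurd (hi _ (mem_insert_of_mem (hm i))) (not_le.2 (hy i hik))
    by_cases hka : k = a
    · subst hka
      exact Or.inl (hr k (le_antisymm (hvamax v hvk) (hvkmax va hva)))
    · by_cases hkb : k = b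
      · subst hkb
        exact Or.inr (hr k (le_antisymm (hvbmax v hvk) (hvkmax vb hvb)))
      · refine absurd (hinj' ?_) hab
        rw [heq a (Ne.symm hka), heq b (Ne.symm hkb), hmab]
  · rintro (rfl | rfl)
    · exact hext a b hab hmab v hva hvamax
    · exact hext b a hab.symm hmab.symm v hvb hvbmax

open Classical in
/-- **Scarf's lemma**: for any colouring in which the `i`-th slack element `s i` gets colour `i`,
some dominant set carries each colour exactly once. -/
theorem exists_isDominant_image_eq_univ [Nonempty I] (hr : ∀ i, Function.Injective (r i))
    (s : I → V) (hsmin : ∀ i v, v ≠ s i → r i (s i) < r i v)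
    (hsmax : ∀ i j v, j ≠ i → v ∉ Set.range s → r i v < r i (s j))
    (hslack : ∃ v, v ∉ Set.range s) (c : V → I) (hc : ∀ i, c (s i) = i) :
    ∃ S, IsDominant r S ∧ #S = Fintype.card I ∧ S.image c = univ := by
  by_contra! hno
  obtain ⟨i₀⟩ := ‹Nonempty I›
  have hsinj : Function.Injective s := Function.LeftInverse.injective hc
  set T₀ : Finset V := (univ.erase i₀).image s with hT₀
  have hT₀card : #T₀ + 1 = Fintype.card I := by
    rw [hT₀, card_image_of_injective _ hsinj, card_erase_add_one (mem_univ _), card_univ]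
  have hT₀mem : ∀ x ∈ T₀, ∃ k ≠ i₀, s k = x := fun x hx => by simpa [hT₀] using hx
  have hT₀dom : IsDominant r T₀ := by
    intro y
    by_cases hy : y ∈ Set.range s
    · obtain ⟨j, rfl⟩ := hy
      refine ⟨j, fun x hx => ?_⟩
      by_cases h : x = s j
      · rw [h]
      · exact (hsmin j x h).le
    · refine ⟨i₀, fun x hx => ?_⟩
      obtain ⟨k, hk, rfl⟩ := hT₀mem x hx
      exact (hsmax i₀ k y hk hy).le
  have hT₀img : T₀.image c = univ.erase i₀ := by
    rw [hT₀, image_image, show c ∘ s = id from funext hc, image_id]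
  set R : Finset (Finset V) := {S | IsDominant r S ∧ #S = Fintype.card I}
  set D : Finset (Finset V) :=
    {T | IsDominant r T ∧ #T + 1 = Fintype.card I ∧ T.image c = univ.erase i₀}
  have hrooms : ∀ T ∈ D, #{S ∈ R | T ⊆ S} = #{v | v ∉ T ∧ IsDominant r (insert v T)} := by
    intro T hT
    simp only [D, mem_filter, mem_univ, true_and] at hT
    symm
    refine card_bij (fun v _ => insert v T) ?_ ?_ ?_
    · intro v hv
      simp only [mem_filter, mem_univ, true_and] at hv
      simp only [R, mem_filter, mem_univ, true_and]
      exact ⟨⟨hv.2, by rw [card_insert_of_notMem hv.1, hT.2.1]⟩, subset_insert v T⟩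
    · intro v hv w hw h
      simp only [mem_filter, mem_univ, true_and] at hv hw
      exact (mem_insert.1 (h ▸ mem_insert_self v T)).resolve_right hv.1
    · intro S hS
      simp only [R, mem_filter, mem_univ, true_and] at hS
      obtain ⟨v, hv⟩ := card_eq_one.1 (show #(S \ T) = 1 by
        rw [card_sdiff_of_subset hS.2]; omega)
      have hvT : v ∉ T := (mem_sdiff.1 (hv ▸ mem_singleton_self v)).2
      have hins : insert v T = S := by
        rw [insert_eq, ← hv, sdiff_union_of_subset hS.2]
      exact ⟨v, by simp only [mem_filter, mem_univ, true_and]; exact ⟨hvT, hins ▸ hS.1.1⟩, hins⟩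
  have hdoors : ∀ S ∈ R, Even #{T ∈ D | T ⊆ S} := by
    intro S hS
    simp only [R, mem_filter, mem_univ, true_and] at hS
    have := even_card_filter_image_erase c i₀ hS.2 (hno S hS.1 hS.2)
    convert this using 1
    symm
    refine card_bij (fun x _ => S.erase x) ?_ ?_ ?_
    · intro x hx
      simp only [mem_filter] at hx
      simp only [D, mem_filter, mem_univ, true_and]
      exact ⟨⟨hS.1.mono (erase_subset _ _), by rw [card_erase_add_one hx.1, hS.2], hx.2⟩,
        erase_subset _ _⟩
    · intro x hx y hy h
      simp only [mem_filter] at hx hy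
      exact erase_injOn S hx.1 hy.1 h
    · intro T hT
      simp only [D, mem_filter, mem_univ, true_and] at hT
      obtain ⟨v, hv⟩ := card_eq_one.1 (show #(S \ T) = 1 by
        rw [card_sdiff_of_subset hT.2]; omega)
      have hvS : v ∈ S := (mem_sdiff.1 (hv ▸ mem_singleton_self v)).1
      have her : S.erase v = T := by
        rw [erase_eq, ← hv, Finset.sdiff_sdiff_eq_self hT.2]
      exact ⟨v, by simp only [mem_filter]; exact ⟨hvS, her ▸ hT.1.2.2⟩, her⟩
  have htwo : ∀ T ∈ D.erase T₀, #{S ∈ R | T ⊆ S} = 2 := by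
    intro T hT
    obtain ⟨hTT₀, hTD⟩ := mem_erase.1 hT
    rw [hrooms T hTD]
    simp only [D, mem_filter, mem_univ, true_and] at hTD
    obtain ⟨v, hvT, hv⟩ : ∃ v ∈ T, v ∉ Set.range s := by
      by_contra! h
      refine hTT₀ (eq_of_subset_of_card_le (fun x hx => ?_) (by omega))
      obtain ⟨i, rfl⟩ := h x hx
      have : c (s i) ∈ T.image c := mem_image_of_mem c hx
      rw [hTD.2.2, hc] at this
      exact mem_image_of_mem s this
    exact hTD.1.card_extensions_eq_two hr ⟨v, hvT⟩ hTD.2.1 fun a =>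
      ⟨s a, fun i hi => ⟨v, hvT, hsmax i a v hi.symm hv⟩⟩
  have hT₀D : T₀ ∈ D := by
    simp only [D, mem_filter, mem_univ, true_and]
    exact ⟨hT₀dom, hT₀card, hT₀img⟩
  have hone : #{S ∈ R | T₀ ⊆ S} = 1 := by
    rw [hrooms T₀ hT₀D]
    obtain ⟨w, hw⟩ := hslack
    obtain ⟨v, hv, hvmax⟩ := ({v | v ∉ Set.range s} : Finset V).exists_max_image (r i₀)
      ⟨w, by simpa using hw⟩
    simp only [mem_filter, mem_univ, true_and] at hv hvmax
    refine card_eq_one.2 ⟨v, ?_⟩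
    ext x
    simp only [mem_filter, mem_univ, true_and, mem_singleton]
    have hnoslack : ∀ y ∉ Set.range s, ∀ i ≠ i₀, r i (s i) < r i y := fun y hy i _ =>
      hsmin i y fun h => hy ⟨i, h.symm⟩
    constructor
    · rintro ⟨hx, hdom⟩
      obtain ⟨i, hi⟩ := hdom v
      have hii : i = i₀ := by
        by_contra hii
        refine absurd (hi (s i) (mem_insert_of_mem ?_)) (not_le.2 (hnoslack v hv i hii))
        exact mem_image_of_mem s (mem_erase.2 ⟨hii, mem_univ i⟩)
      subst hii
      have hvx := hi x (mem_insert_self _ _)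
      have hxs : x ∉ Set.range s := by
        rintro ⟨j, rfl⟩
        by_cases hj : j = i
        · subst hj
          exact absurd hvx (not_le.2 (hsmin j v fun h => hv ⟨j, h.symm⟩))
        · exact hx (mem_image_of_mem s (mem_erase.2 ⟨hj, mem_univ j⟩))
      exact hr i (le_antisymm (hvmax x hxs) hvx)
    · rintro rfl
      refine ⟨fun h => ?_, fun y => ?_⟩
      · obtain ⟨k, -, hk⟩ := hT₀mem x h
        exact hv ⟨k, hk⟩
      · by_cases hy : y ∈ Set.range s
        · obtain ⟨j, rfl⟩ := hy
          refine ⟨j, fun z _ => ?_⟩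
          by_cases h : z = s j
          · rw [h]
          · exact (hsmin j z h).le
        · refine ⟨i₀, fun z hz => ?_⟩
          rcases mem_insert.1 hz with rfl | hz
          · exact hvmax y hy
          · obtain ⟨k, hk, rfl⟩ := hT₀mem z hz
            exact (hsmax i₀ k y hk hy).le
  have hcount := sum_card_bipartiteAbove_eq_sum_card_bipartiteBelow
    (s := D) (t := R) (fun T S : Finset V => T ⊆ S)
  simp only [bipartiteAbove, bipartiteBelow] at hcount
  rw [← add_sum_erase D _ hT₀D, hone, sum_congr rfl htwo, sum_const, smul_eq_mul] at hcount
  have heven : Even (∑ S ∈ R, #{T ∈ D | T ⊆ S}) := even_sum _ hdoors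
  rw [← hcount] at heven
  obtain ⟨k, hk⟩ := heven
  omega

end Scarf

section Brouwer
open Finset

variable {I : Type*} [Fintype I] [Nonempty I]

open Classical in
/-- For any colouring of the grid points of the simplex of side `m`, there is a grid point which is
close to points of every colour `i`, save those for which it is close to the `i`-th face. -/
theorem exists_grid_point_near_colours (m : ℕ) (c : (I → ℕ) → I) :
    ∃ x₀ : I → ℕ, ∑ i, x₀ i = m ∧ ∀ i, x₀ i ≤ Fintype.card I ∨
      ∃ x : I → ℕ, ∑ j, x j = m ∧ c x = i ∧
        ∀ k, x k ≤ x₀ k + Fintype.card I ∧ x₀ k ≤ x k + Fintype.card I := by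
  let G := {x : I → ℕ // x ∈ piAntidiag (univ : Finset I) m}
  have hG : ∀ x : G, ∑ i, x.1 i = m := fun x => (mem_piAntidiag.1 x.2).1
  have hle : ∀ (x : G) i, x.1 i ≤ m := fun x i =>
    (single_le_sum (fun _ _ => Nat.zero_le _) (mem_univ i)).trans (hG x).le
  let e : G ⊕ I → ℕ := fun v => Fintype.equivFin (G ⊕ I) v
  have he : Function.Injective e := Fin.val_injective.comp (Fintype.equivFin _).injective
  let h : I → G ⊕ I → ℤ := fun i v => v.elim (fun x => (x.1 i : ℤ))
    fun j => if j = i then -1 else m + 1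
  let r : I → G ⊕ I → ℤ ×ₗ ℕ := fun i v => toLex (h i v, e v)
  have hr : ∀ i, Function.Injective (r i) := fun i v w hvw =>
    he (congrArg (fun z => (ofLex z).2) hvw)
  have hlt : ∀ i v w, h i v < h i w → r i v < r i w := fun i v w hvw =>
    Prod.Lex.toLex_lt_toLex.2 (Or.inl hvw)
  have hle_of_le : ∀ i v w, r i v ≤ r i w → h i v ≤ h i w := fun i v w hvw =>
    not_lt.1 fun hlt' => absurd hvw (not_le.2 (hlt i w v hlt'))
  have hinl : ∀ i x, h i (Sum.inl x) = x.1 i := fun i x => rfl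
  have hself : ∀ i, h i (Sum.inr i) = -1 := fun i => if_pos rfl
  have hother : ∀ i j, j ≠ i → h i (Sum.inr j) = m + 1 := fun i j hij => if_neg hij
  have hgrid : ∀ x : I → ℕ, ∑ i, x i = m → ∃ v : G, v.1 = x := fun x hx =>
    ⟨⟨x, mem_piAntidiag.2 ⟨hx, fun i _ => mem_univ i⟩⟩, rfl⟩
  obtain ⟨i₁⟩ := id ‹Nonempty I›
  obtain ⟨w, -⟩ := hgrid (Pi.single i₁ m) (by simp)
  obtain ⟨S, hS, -, hSc⟩ := exists_isDominant_image_eq_univ hr Sum.inr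
    (by
      rintro i (x | j) hv
      · refine hlt _ _ _ ?_
        rw [hself, hinl]
        omega
      · refine hlt _ _ _ ?_
        rw [hself, hother i j (by rintro rfl; exact hv rfl)]
        omega)
    (by
      rintro i j (x | k) hij hv
      · refine hlt _ _ _ ?_
        rw [hother i j hij, hinl]
        have := hle x i
        omega
      · exact absurd ⟨k, rfl⟩ hv)
    ⟨Sum.inl w, by simp⟩ (fun v => v.elim (fun x => c x.1) id) (fun i => rfl)
  have hcol : ∀ i, Sum.inr i ∉ S → ∃ x : G, Sum.inl x ∈ S ∧ c x.1 = i := by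
    intro i hi
    obtain ⟨v, hv, hvi⟩ := mem_image.1 (hSc ▸ mem_univ i)
    rcases v with x | j
    · exact ⟨x, hv, hvi⟩
    · simp only [Sum.elim_inr, id_eq] at hvi
      exact absurd (hvi ▸ hv) hi
  have hne : ∃ x : G, Sum.inl x ∈ S := by
    obtain ⟨i, hi⟩ := hS (Sum.inl w)
    by_cases hiS : Sum.inr i ∈ S
    · have := hle_of_le _ _ _ (hi _ hiS)
      rw [hself, hinl] at this
      omega
    · exact (hcol i hiS).imp fun x hx => hx.1
  obtain ⟨x₀, hx₀⟩ := hne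
  choose a ha hamin using fun i => ({x : G | Sum.inl x ∈ S} : Finset G).exists_min_image
    (fun x => x.1 i) ⟨x₀, by simpa using hx₀⟩
  simp only [mem_filter, mem_univ, true_and] at ha hamin
  let μ : I → ℕ := fun i => if Sum.inr i ∈ S then 0 else (a i).1 i
  have hμle : ∀ x : G, Sum.inl x ∈ S → ∀ i, μ i ≤ x.1 i := by
    intro x hx i
    by_cases hi : Sum.inr i ∈ S
    · simp [μ, hi]
    · simpa [μ, hi] using hamin i x hx
  have hμsum : m < ∑ i, μ i + Fintype.card I := by
    by_contra! hm
    obtain ⟨y, hy⟩ := hgrid (fun i => μ i + 1 + (Pi.single i₁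
      (m - (∑ i, μ i + Fintype.card I)) : I → ℕ) i) (by
        simp only [sum_add_distrib, sum_const, card_univ, smul_eq_mul, mul_one, sum_pi_single',
          mem_univ, if_true]
        omega)
    have hyμ : ∀ i, μ i + 1 ≤ y.1 i := fun i => by rw [hy]; exact Nat.le_add_right _ _
    obtain ⟨i, hi⟩ := hS (Sum.inl y)
    by_cases hiS : Sum.inr i ∈ S
    · have := hle_of_le _ _ _ (hi _ hiS)
      rw [hself, hinl] at this
      omega
    · have := hle_of_le _ _ _ (hi _ (ha i))
      rw [hinl, hinl] at this
      have hyi := hyμ i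
      simp only [μ, hiS, if_false] at hyi
      omega
  have hlt_add : ∀ x : G, Sum.inl x ∈ S → ∀ k, x.1 k < μ k + Fintype.card I := by
    intro x hx k
    have h1 := hG x
    rw [← add_sum_erase _ _ (mem_univ k)] at h1 hμsum
    have h2 : ∑ i ∈ univ.erase k, μ i ≤ ∑ i ∈ univ.erase k, x.1 i :=
      sum_le_sum fun i _ => hμle x hx i
    omega
  refine ⟨x₀.1, hG x₀, fun i => ?_⟩
  by_cases hi : Sum.inr i ∈ S
  · left
    have := hlt_add x₀ hx₀ i
    simp only [μ, hi, if_true] at this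
    omega
  · right
    obtain ⟨x, hx, hxi⟩ := hcol i hi
    refine ⟨x.1, hG x, hxi, fun k => ?_⟩
    have h1 := hlt_add x₀ hx₀ k
    have h2 := hlt_add x hx k
    have h3 := hμle x hx k
    have h4 := hμle x₀ hx₀ k
    omega

/-- Approximate fixed points of a continuous self-map of the standard simplex. -/
theorem exists_forall_sub_le_of_continuousOn_stdSimplex {f : (I → ℝ) → I → ℝ}
    (hf : ContinuousOn f (stdSimplex ℝ I))
    (hmaps : Set.MapsTo f (stdSimplex ℝ I) (stdSimplex ℝ I)) {ε : ℝ} (hε : 0 < ε) :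
    ∃ p ∈ stdSimplex ℝ I, ∀ i, p i - f p i ≤ ε := by
  obtain ⟨δ, hδ, hfδ⟩ := Metric.uniformContinuousOn_iff.1
    ((isCompact_stdSimplex ℝ I).uniformContinuousOn_of_continuous hf) (ε / 2) (half_pos hε)
  obtain ⟨m, hm⟩ := exists_nat_gt (Fintype.card I / min (ε / 2) δ)
  have hmin : 0 < min (ε / 2) δ := lt_min (half_pos hε) hδ
  have hm0 : (0 : ℝ) < m := lt_of_le_of_lt (by positivity) hm
  have hsmall : (Fintype.card I : ℝ) / m < min (ε / 2) δ := (div_lt_comm₀ hmin hm0).1 hm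
  have hmem : ∀ x : I → ℕ, ∑ i, x i = m → (fun i => (x i : ℝ) / m) ∈ stdSimplex ℝ I := by
    intro x hx
    refine ⟨fun i => by positivity, ?_⟩
    rw [← sum_div, ← Nat.cast_sum, hx, div_self hm0.ne']
  have hcol : ∀ x : I → ℕ, ∃ i, ∑ i, x i = m →
      (x i : ℝ) / m ≤ f (fun i => (x i : ℝ) / m) i := by
    intro x
    by_contra! hx
    have hsum := (hx (Classical.arbitrary I)).1
    have := sum_lt_sum_of_nonempty univ_nonempty fun i _ => (hx i).2
    rw [(hmem x hsum).2, (hmaps (hmem x hsum)).2] at this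
    exact lt_irrefl _ this
  choose c hc using hcol
  obtain ⟨x₀, hx₀, hnear⟩ := exists_grid_point_near_colours m c
  refine ⟨_, hmem x₀ hx₀, fun i => ?_⟩
  rcases hnear i with hi | ⟨x, hx, hxi, hclose⟩
  · have h1 : (x₀ i : ℝ) / m ≤ Fintype.card I / m := by gcongr
    have h2 := (hmaps (hmem x₀ hx₀)).1 i
    have h3 := hsmall.trans_le (min_le_left _ _)
    linarith
  · have habs : ∀ k, |(x₀ k : ℝ) / m - x k / m| ≤ Fintype.card I / m := by
      intro k
      have h1 : (x k : ℝ) ≤ x₀ k + Fintype.card I := by exact_mod_cast (hclose k).1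
      have h2 : (x₀ k : ℝ) ≤ x k + Fintype.card I := by exact_mod_cast (hclose k).2
      rw [← sub_div, abs_div, abs_of_pos hm0]
      gcongr
      rw [abs_le]
      constructor <;> linarith
    have hdist : dist (fun i => (x₀ i : ℝ) / m) (fun i => (x i : ℝ) / m) < δ := by
      refine lt_of_le_of_lt ((dist_pi_le_iff (by positivity)).2 fun k => ?_)
        (hsmall.trans_le (min_le_right _ _))
      rw [Real.dist_eq]
      exact habs k
    have h1 := (dist_le_pi_dist _ _ i).trans_lt (hfδ _ (hmem x₀ hx₀) _ (hmem x hx) hdist)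
    rw [Real.dist_eq] at h1
    have h2 := hc x hx
    rw [hxi] at h2
    have h3 := abs_le.1 (habs i)
    have h4 := abs_lt.1 h1
    have h5 := hsmall.trans_le (min_le_left _ _)
    linarith

/-- **Brouwer's fixed point theorem** for the standard simplex. -/
theorem exists_fixedPoint_stdSimplex {f : (I → ℝ) → I → ℝ}
    (hf : ContinuousOn f (stdSimplex ℝ I))
    (hmaps : Set.MapsTo f (stdSimplex ℝ I) (stdSimplex ℝ I)) :
    ∃ p ∈ stdSimplex ℝ I, f p = p := by
  classical
  have hcont : ContinuousOn (fun p => ∑ i, max 0 (p i - f p i)) (stdSimplex ℝ I) :=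
    continuousOn_finsetSum _ fun i _ => continuousOn_const.sup
      ((continuous_apply i).continuousOn.sub ((continuous_apply i).comp_continuousOn hf))
  obtain ⟨p, hp, hpmin⟩ := (isCompact_stdSimplex ℝ I).exists_isMinOn
    ⟨_, single_mem_stdSimplex ℝ (Classical.arbitrary I)⟩ hcont
  have hzero : ∑ i, max 0 (p i - f p i) ≤ 0 := by
    refine le_of_forall_pos_le_add fun ε hε => ?_
    have hcard : (0 : ℝ) < Fintype.card I := by exact_mod_cast Fintype.card_pos
    obtain ⟨q, hq, hqε⟩ := exists_forall_sub_le_of_continuousOn_stdSimplex hf hmaps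
      (div_pos hε hcard)
    calc ∑ i, max 0 (p i - f p i) ≤ ∑ i, max 0 (q i - f q i) := hpmin hq
      _ ≤ ∑ _i : I, ε / Fintype.card I :=
        sum_le_sum fun i _ => max_le (by positivity) (hqε i)
      _ = 0 + ε := by
        rw [sum_const, card_univ, nsmul_eq_mul, mul_div_cancel₀ _ hcard.ne', zero_add]
  have hle : ∀ i, p i ≤ f p i := by
    intro i
    have := (single_le_sum (f := fun i => max 0 (p i - f p i))
      (fun _ _ => le_max_left _ _) (mem_univ i)).trans hzero
    have := (le_max_right _ _).trans this
    linarith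
  refine ⟨p, hp, funext fun i => ?_⟩
  exact ((sum_eq_sum_iff_of_le fun i _ => hle i).1 (hp.2.trans (hmaps hp).2.symm) i
    (mem_univ i)).symm

/-- The **Knaster–Kuratowski–Mazurkiewicz lemma**. -/
theorem exists_mem_forall_of_stdSimplex_cover {A : I → Set (I → ℝ)} (hA : ∀ i, IsClosed (A i))
    (hcover : ∀ p ∈ stdSimplex ℝ I, ∃ i, 0 < p i ∧ p ∈ A i) :
    ∃ p ∈ stdSimplex ℝ I, ∀ i, p ∈ A i := by
  classical
  have hne : ∀ i, (A i).Nonempty := by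
    intro i
    obtain ⟨j, hj, hjA⟩ := hcover _ (single_mem_stdSimplex ℝ i)
    by_cases h : j = i
    · exact ⟨_, h ▸ hjA⟩
    · simp [h] at hj
  let d : I → (I → ℝ) → ℝ := fun i p => Metric.infDist p (A i)
  have hd : ∀ i p, 0 ≤ d i p := fun i p => Metric.infDist_nonneg
  have hdcont : ∀ i, Continuous (d i) := fun i => Metric.continuous_infDist_pt _
  have hpos : ∀ p, 0 < 1 + ∑ i, d i p := fun p =>
    add_pos_of_pos_of_nonneg one_pos (sum_nonneg fun i _ => hd i p)
  obtain ⟨p, hp, hfix⟩ := exists_fixedPoint_stdSimplex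
    (f := fun p i => (p i + d i p) / (1 + ∑ j, d j p))
    (continuous_pi fun i => ((continuous_apply i).add (hdcont i)).div
      (continuous_const.add (continuous_finsetSum _ fun j _ => hdcont j))
      fun p => (hpos p).ne').continuousOn
    (fun p hp => ⟨fun i => div_nonneg (add_nonneg (hp.1 i) (hd i p)) (hpos p).le, by
      rw [← sum_div, sum_add_distrib, hp.2, div_self (hpos p).ne']⟩)
  have heq : ∀ i, d i p = p i * ∑ j, d j p := by
    intro i
    have := (div_eq_iff (hpos p).ne').1 (congrFun hfix i)
    linarith
  obtain ⟨i, hi, hiA⟩ := hcover p hp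
  have hzero : ∑ j, d j p = 0 := by
    have hdi : d i p = 0 := Metric.infDist_zero_of_mem hiA
    rw [heq i] at hdi
    exact (mul_eq_zero.1 hdi).resolve_left hi.ne'
  refine ⟨p, hp, fun j => ((hA j).mem_iff_infDist_zero (hne j)).2 ?_⟩
  have := heq j
  rwa [hzero, mul_zero] at this

end Brouwer

section Exponentials

theorem nexp_eq_inv_pexp (r : ℝ) (t : ℝ≥0∞) : nexp r t = (pexp r t)⁻¹ := by
  unfold nexp pexp
  split_ifs
  · simp
  · rw [Real.exp_neg, ENNReal.ofReal_inv_of_pos (Real.exp_pos _)]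

theorem continuous_pexp {r : ℝ} (hr : 0 < r) : Continuous (pexp r) := by
  rw [continuous_iff_continuousAt]
  intro t
  by_cases ht : t = ∞
  · subst ht
    have hle : ∀ a, ENNReal.ofReal r * a ≤ pexp r a := by
      intro a
      unfold pexp
      split_ifs with ha
      · exact le_top
      · rw [← ENNReal.ofReal_toReal ha, ← ENNReal.ofReal_mul hr.le,
          ENNReal.toReal_ofReal ENNReal.toReal_nonneg]
        exact ENNReal.ofReal_le_ofReal (by linarith [Real.add_one_le_exp (r * a.toReal)])
    have hr0 : ENNReal.ofReal r ≠ 0 := (ENNReal.ofReal_pos.2 hr).ne'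
    have hlim : Tendsto (fun a => ENNReal.ofReal r * a) (nhds ∞) (nhds ∞) := by
      have := (ENNReal.continuous_const_mul (ENNReal.ofReal_ne_top (r := r))).tendsto ∞
      rwa [ENNReal.mul_top hr0] at this
    have htop : pexp r ∞ = ∞ := if_pos rfl
    rw [ContinuousAt, htop]
    exact tendsto_nhds_top_mono hlim (Eventually.of_forall hle)
  · have hev : (fun t : ℝ≥0∞ => ENNReal.ofReal (Real.exp (r * t.toReal))) =ᶠ[nhds t] pexp r := by
      filter_upwards [isOpen_ne.mem_nhds ht] with a ha
      exact (if_neg ha).symm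
    refine ContinuousAt.congr ?_ hev
    exact ENNReal.continuous_ofReal.continuousAt.comp (Real.continuous_exp.continuousAt.comp
      (continuousAt_const.mul (ENNReal.continuousAt_toReal ht)))

theorem continuous_nexp {r : ℝ} (hr : 0 < r) : Continuous (nexp r) := by
  rw [show nexp r = fun t => (pexp r t)⁻¹ from funext (nexp_eq_inv_pexp r)]
  exact continuous_inv.comp (continuous_pexp hr)

theorem pexp_ne_zero (r : ℝ) (t : ℝ≥0∞) : pexp r t ≠ 0 := by
  unfold pexp
  split_ifs
  · exact ENNReal.top_ne_zero
  · exact (ENNReal.ofReal_pos.2 (Real.exp_pos _)).ne'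

theorem nexp_ne_zero (r : ℝ) {t : ℝ≥0∞} (ht : t ≠ ∞) : nexp r t ≠ 0 := by
  rw [nexp, if_neg ht]
  exact (ENNReal.ofReal_pos.2 (Real.exp_pos _)).ne'

end Exponentials

/-- The product of continuous `[0,∞]`-valued functions is lower semicontinuous, even where it
takes the form `0 * ∞`. -/
theorem Continuous.lowerSemicontinuous_ennreal_mul {X : Type*} [TopologicalSpace X]
    {f g : X → ℝ≥0∞} (hf : Continuous f) (hg : Continuous g) :
    LowerSemicontinuous fun x => f x * g x := by
  intro x
  by_cases h : f x * g x = 0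
  · intro y hy
    simp only [h] at hy
    exact absurd hy not_lt_zero
  · have hne := mul_ne_zero_iff.1 h
    exact ContinuousAt.lowerSemicontinuousAt
      (ENNReal.Tendsto.mul (hf.tendsto x) (Or.inl hne.1) (hg.tendsto x) (Or.inl hne.2))

/-- A lower semicontinuous function of a forecast whose expectation under each forecast is at most
`C` is bounded by `C`, whatever the outcome, at some forecast (Levin's lemma). -/
theorem exists_forall_le_of_expect_le {Ω : Type*} [Fintype Ω] [Nonempty Ω] {C : ℝ≥0∞}
    {F : (Ω → ℝ) → Ω → ℝ≥0∞}
    (hF : ∀ ω, LowerSemicontinuous fun π : stdSimplex ℝ Ω => F π ω)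
    (hexp : ∀ π ∈ stdSimplex ℝ Ω, expect π (F π) ≤ C) :
    ∃ π ∈ stdSimplex ℝ Ω, ∀ ω, F π ω ≤ C := by
  obtain ⟨π, hπ, hmem⟩ := exists_mem_forall_of_stdSimplex_cover
    (A := fun ω => Subtype.val '' {π : stdSimplex ℝ Ω | F π ω ≤ C})
    (fun ω => (isClosed_stdSimplex ℝ Ω).isClosedEmbedding_subtypeVal.isClosedMap _
      ((hF ω).isClosed_preimage C))
    (by
      intro π hπ
      by_contra! hlt
      replace hlt : ∀ ω, 0 < π ω → C < F π ω := fun ω hω =>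
        not_le.1 fun h => hlt ω hω ⟨⟨π, hπ⟩, h, rfl⟩
      have hsupp : ∑ ω with 0 < π ω, ENNReal.ofReal (π ω) = 1 := by
        rw [Finset.sum_filter_of_ne fun ω _ h => ENNReal.ofReal_pos.1 (pos_iff_ne_zero.2 h),
          ← ENNReal.ofReal_sum_of_nonneg fun ω _ => hπ.1 ω, hπ.2, ENNReal.ofReal_one]
      have hnonempty : (Finset.univ.filter fun ω => 0 < π ω).Nonempty := by
        by_contra h
        rw [Finset.not_nonempty_iff_eq_empty.1 h] at hsupp
        simp at hsupp
      refine absurd (hexp π hπ) (not_le.2 ?_)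
      calc C = ∑ ω with 0 < π ω, ENNReal.ofReal (π ω) * C := by
            rw [← Finset.sum_mul, hsupp, one_mul]
        _ < ∑ ω with 0 < π ω, ENNReal.ofReal (π ω) * F π ω :=
            ENNReal.sum_lt_sum_of_nonempty hnonempty fun ω hω => by
              have hω := (Finset.mem_filter.1 hω).2
              exact (ENNReal.mul_lt_mul_iff_right (ENNReal.ofReal_pos.2 hω).ne'
                ENNReal.ofReal_ne_top).2 (hlt ω hω)
        _ ≤ expect π (F π) :=
            Finset.sum_le_sum_of_subset (Finset.filter_subset _ _))
  refine ⟨π, hπ, fun ω => ?_⟩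
  obtain ⟨π', h, rfl⟩ := hmem ω
  exact h

/-- If the weight `p` multiplied by a product of factors `exp(ηℓ/c) exp(-ηg)` is at most `1`, then
the losses `ℓ` exceed `c` times the losses `g` by at most `(c/η) ln (1/p)` altogether. -/
theorem sum_le_of_mul_prod_pexp_mul_nexp_le_one {ι : Type*} {s : Finset ι} {c η p : ℝ}
    (hc : 0 < c) (hη : 0 < η) (hp : 0 < p) (hp1 : p ≤ 1) (l g : ι → ℝ≥0∞)
    (h : ENNReal.ofReal p * ∏ k ∈ s, (pexp (η / c) (l k) * nexp η (g k)) ≤ 1) :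
    ∑ k ∈ s, l k ≤ ENNReal.ofReal c * ∑ k ∈ s, g k +
      ENNReal.ofReal ((c / η) * Real.log (1 / p)) := by
  have hc0 : ENNReal.ofReal c ≠ 0 := (ENNReal.ofReal_pos.2 hc).ne'
  have hp0 : ENNReal.ofReal p ≠ 0 := (ENNReal.ofReal_pos.2 hp).ne'
  by_cases hg : ∑ k ∈ s, g k = ∞
  · simp [hg, ENNReal.mul_top hc0]
  replace hg : ∀ k ∈ s, g k ≠ ∞ := fun k hk => (ENNReal.sum_ne_top.1 hg) k hk
  have hfac : ∀ k ∈ s, pexp (η / c) (l k) * nexp η (g k) ≠ 0 := fun k hk =>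
    mul_ne_zero (pexp_ne_zero _ _) (nexp_ne_zero η (hg k hk))
  have hl : ∀ k ∈ s, l k ≠ ∞ := by
    classical
    intro k hk hlk
    rw [← Finset.mul_prod_erase s _ hk, hlk, pexp, if_pos rfl,
      ENNReal.top_mul (nexp_ne_zero η (hg k hk)),
      ENNReal.top_mul (Finset.prod_ne_zero_iff.2 fun j hj => hfac j (Finset.mem_of_mem_erase hj)),
      ENNReal.mul_top hp0] at h
    exact absurd h (by simp)
  have hterm : ∀ k ∈ s, pexp (η / c) (l k) * nexp η (g k) =
      ENNReal.ofReal (Real.exp (η / c * (l k).toReal - η * (g k).toReal)) := by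
    intro k hk
    rw [pexp, nexp, if_neg (hl k hk), if_neg (hg k hk),
      ← ENNReal.ofReal_mul (Real.exp_pos _).le, ← Real.exp_add, sub_eq_add_neg]
  rw [Finset.prod_congr rfl hterm, ← ENNReal.ofReal_prod_of_nonneg fun _ _ => (Real.exp_pos _).le,
    ← Real.exp_sum, ← ENNReal.ofReal_mul hp.le, ENNReal.ofReal_le_one, Finset.sum_sub_distrib,
    ← Finset.mul_sum, ← Finset.mul_sum] at h
  have hlog := Real.log_nonpos (by positivity) h
  rw [Real.log_mul hp.ne' (Real.exp_pos _).ne', Real.log_exp] at hlog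
  have hlogp : 0 ≤ Real.log (1 / p) := Real.log_nonneg ((one_le_div hp).2 hp1)
  rw [← ENNReal.ofReal_toReal (ENNReal.sum_ne_top.2 hl),
    ← ENNReal.ofReal_toReal (ENNReal.sum_ne_top.2 hg), ENNReal.toReal_sum hl,
    ENNReal.toReal_sum hg, ← ENNReal.ofReal_mul hc.le,
    ← ENNReal.ofReal_add (by positivity) (by positivity)]
  refine ENNReal.ofReal_le_ofReal ?_
  rw [one_div, Real.log_inv]
  have hmul := mul_le_mul_of_nonneg_left hlog (div_nonneg hc.le hη.le)
  field_simp at hmul ⊢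
  linarith

/-- Theorem 7 of the paper: the Defensive Forecasting Algorithm for
second-guessing experts (continuous maps `Γ_n^θ : Λ → Λ`) achieves the
usual loss bound. -/
theorem dfa_second_guessing
    {Ω : Type*} [Fintype Ω] [Nonempty Ω]
    (Λ : Set (Ω → ℝ≥0∞))
    (c η : ℝ) (hc : 1 ≤ c) (hη : 0 < η)
    (lam : (Ω → ℝ) → Ω → ℝ≥0∞)
    (hlamCont : ContinuousOn lam (stdSimplex ℝ Ω))
    (hlamMem : ∀ π ∈ stdSimplex ℝ Ω, lam π ∈ Λ)
    (hqcont : ∀ g ∈ Λ, ∀ ω : Ω,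
      ContinuousOn (fun π => pexp (η / c) (lam π ω) * nexp η (g ω)) (stdSimplex ℝ Ω))
    (hqsuper : ∀ g ∈ Λ, ∀ π ∈ stdSimplex ℝ Ω,
      expect π (fun ω => pexp (η / c) (lam π ω) * nexp η (g ω)) ≤ 1)
    {Θ : Type*} [Countable Θ] [Nonempty Θ]
    (P₀ : Θ → ℝ) (hP₀pos : ∀ θ, 0 < P₀ θ) (hP₀le : ∀ θ, P₀ θ ≤ 1)
    (hP₀sum : ∑' θ, ENNReal.ofReal (P₀ θ) = 1)
    (Γ : ℕ → Θ → (Ω → ℝ≥0∞) → Ω → ℝ≥0∞)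
    (hΓcont : ∀ n θ, ContinuousOn (Γ n θ) Λ)
    (hΓmaps : ∀ n θ, ∀ γ ∈ Λ, Γ n θ γ ∈ Λ)
    (πs : ℕ → Ω → ℝ) (hπs : ∀ n, πs n ∈ stdSimplex ℝ Ω)
    (ωs : ℕ → Ω)
    (W : ℕ → ℝ≥0∞)
    (hW : ∀ n, W n = ∑' θ, ENNReal.ofReal (P₀ θ) *
      ∏ k ∈ Finset.range n,
        (pexp (η / c) (lam (πs k) (ωs k)) * nexp η (Γ k θ (lam (πs k)) (ωs k)))) :
    -- (i) a suitable next decision always exists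
    (∀ n : ℕ, ∃ πn ∈ stdSimplex ℝ Ω, ∀ ω : Ω,
      (∑' θ, ENNReal.ofReal (P₀ θ) *
        (∏ k ∈ Finset.range n,
          (pexp (η / c) (lam (πs k) (ωs k)) * nexp η (Γ k θ (lam (πs k)) (ωs k)))) *
        (pexp (η / c) (lam πn ω) * nexp η (Γ n θ (lam πn) ω))) ≤ W n) ∧
    -- (ii) the loss bound
    (∀ N : ℕ, 1 ≤ N → (∀ n < N, W (n + 1) ≤ W n) → ∀ θ : Θ,
      ∑ n ∈ Finset.range N, lam (πs n) (ωs n) ≤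
        ENNReal.ofReal c * ∑ n ∈ Finset.range N, Γ n θ (lam (πs n)) (ωs n) +
          ENNReal.ofReal ((c / η) * Real.log (1 / P₀ θ))) := by
  have hηc : 0 < η / c := div_pos hη (one_pos.trans_le hc)
  constructor
  · intro n
    by_cases hWn : W n = ∞
    · exact ⟨πs n, hπs n, fun ω => hWn ▸ le_top⟩
    set a : Θ → ℝ≥0∞ := fun θ => ENNReal.ofReal (P₀ θ) * ∏ k ∈ Finset.range n,
      (pexp (η / c) (lam (πs k) (ωs k)) * nexp η (Γ k θ (lam (πs k)) (ωs k))) with ha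
    have hWa : W n = ∑' θ, a θ := hW n
    have ha_ne : ∀ θ, a θ ≠ ∞ := fun θ => ENNReal.ne_top_of_tsum_ne_top (hWa ▸ hWn) θ
    have hlam : Continuous fun π : stdSimplex ℝ Ω => lam π :=
      continuousOn_iff_continuous_domRestrict.1 hlamCont
    have hΓlam : ∀ θ, Continuous fun π : stdSimplex ℝ Ω => Γ n θ (lam π) := fun θ =>
      continuousOn_iff_continuous_domRestrict.1 ((hΓcont n θ).comp hlamCont hlamMem)
    refine exists_forall_le_of_expect_le
      (F := fun π ω => ∑' θ, a θ * (pexp (η / c) (lam π ω) * nexp η (Γ n θ (lam π) ω)))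
      (fun ω => lowerSemicontinuous_tsum fun θ => ?_) fun π hπ => ?_
    · simp only [← mul_assoc]
      exact ((ENNReal.continuous_const_mul (ha_ne θ)).comp ((continuous_pexp hηc).comp
          ((continuous_apply ω).comp hlam))).lowerSemicontinuous_ennreal_mul
        ((continuous_nexp hη).comp ((continuous_apply ω).comp (hΓlam θ)))
    · calc expect π (fun ω => ∑' θ, a θ * (pexp (η / c) (lam π ω) * nexp η (Γ n θ (lam π) ω)))
          = ∑' θ, a θ * expect π (fun ω =>
              pexp (η / c) (lam π ω) * nexp η (Γ n θ (lam π) ω)) := by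
            simp only [expect, ← ENNReal.tsum_mul_left, Finset.mul_sum]
            rw [← Summable.tsum_finsetSum fun _ _ => ENNReal.summable]
            simp only [mul_left_comm]
        _ ≤ ∑' θ, a θ := ENNReal.tsum_le_tsum fun θ => mul_le_of_le_one_right' <|
            hqsuper _ (hΓmaps n θ _ (hlamMem π hπ)) π hπ
        _ = W n := hWa.symm
  · intro N _ hdec θ
    have hWle : ∀ n ≤ N, W n ≤ 1 := by
      intro n
      induction n with
      | zero => intro _; simp [hW, hP₀sum]
      | succ k ih => exact fun hk => (hdec k hk).trans (ih (Nat.le_of_succ_le hk))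
    refine sum_le_of_mul_prod_pexp_mul_nexp_le_one (one_pos.trans_le hc) hη (hP₀pos θ) (hP₀le θ)
      _ _ (le_trans ?_ (hWle N le_rfl))
    rw [hW N]
    exact ENNReal.le_tsum θ
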